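/- Let H be a Hopf algebra over a commutative ring k. Define linear maps R₂, R₃ : H⊗H → H⊗H on simple tensors by R₂(x⊗y) = S(y⁽¹⁾) ⊗ y⁽²⁾ x y⁽³⁾ and R₃(x⊗y) = x⁽¹⁾S(y⁽¹⁾)S(x⁽²⁾) ⊗ x⁽³⁾ y⁽²⁾ y⁽³⁾. Then both maps satisfy braided commutativity with the multiplication μ of H: μ∘R₂ = μ and μ∘R₃ = μ. -/

import Mathlib

open TensorProduct LinearMap


noncomputable section

variable (k : Type*) [CommRing k] (H : Type*) [Ring H] [HopfAlgebra k H]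

/-- The iterated comultiplication `y ↦ y⁽¹⁾ ⊗ y⁽²⁾ ⊗ y⁽³⁾`. -/
def comul₂ : H →ₗ[k] (H ⊗[k] H) ⊗[k] H :=
  (Coalgebra.comul (R := k) (A := H)).rTensor H ∘ₗ Coalgebra.comul (R := k) (A := H)

/-- The transposition of the last two factors of a four-fold tensor product. -/
def swapLast : ((H ⊗[k] H) ⊗[k] H) ⊗[k] H →ₗ[k] ((H ⊗[k] H) ⊗[k] H) ⊗[k] H :=
  (TensorProduct.assoc k (H ⊗[k] H) H H).symm.toLinearMap ∘ₗ
    (TensorProduct.comm k H H).toLinearMap.lTensor (H ⊗[k] H) ∘ₗ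
    (TensorProduct.assoc k (H ⊗[k] H) H H).toLinearMap

/-- Given `c : H → H⊗H⊗H`, `y ↦ y_I ⊗ y_{II} ⊗ y_{III}`, and `s : H → H`, the
map `x ⊗ y ↦ y_I ⊗ s(y_{II}) x y_{III}`. -/
def adjCore (c : H →ₗ[k] (H ⊗[k] H) ⊗[k] H) (s : H →ₗ[k] H) :
    H ⊗[k] H →ₗ[k] H ⊗[k] H :=
  (LinearMap.mul' k H).lTensor H ∘ₗ (TensorProduct.assoc k H H H).toLinearMap ∘ₗ
    (((LinearMap.mul' k H).lTensor H ∘ₗ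
        (TensorProduct.assoc k H H H).toLinearMap).rTensor H) ∘ₗ
    swapLast k H ∘ₗ
    ((((s.lTensor H).rTensor H) ∘ₗ c).rTensor H) ∘ₗ
    (TensorProduct.comm k H H).toLinearMap

/-- The adjoint R-matrix `R_H(x ⊗ y) = y⁽¹⁾ ⊗ S(y⁽²⁾) x y⁽³⁾` of a Hopf
algebra. -/
def adjR : H ⊗[k] H →ₗ[k] H ⊗[k] H :=
  adjCore k H (comul₂ k H) (HopfAlgebra.antipode (R := k) (A := H))

/-- Wada's second Hopf braiding `R₂(x ⊗ y) = S(y⁽¹⁾) ⊗ y⁽²⁾ x y⁽³⁾`. -/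
def wadaHopfR2 : H ⊗[k] H →ₗ[k] H ⊗[k] H :=
  (HopfAlgebra.antipode (R := k) (A := H)).rTensor H ∘ₗ
    adjCore k H (comul₂ k H) LinearMap.id

/-- The map `a ⊗ d ↦ a⁽¹⁾ S(d) S(a⁽²⁾)`. -/
def wadaHopfAux1 : H ⊗[k] H →ₗ[k] H :=
  LinearMap.mul' k H ∘ₗ (LinearMap.mul' k H).rTensor H ∘ₗ
    ((TensorProduct.assoc k H H H).symm.toLinearMap ∘ₗ
      (TensorProduct.comm k H H).toLinearMap.lTensor H ∘ₗ
      (TensorProduct.assoc k H H H).toLinearMap) ∘ₗ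
    (HopfAlgebra.antipode (R := k) (A := H)).lTensor (H ⊗[k] H) ∘ₗ
    (((HopfAlgebra.antipode (R := k) (A := H)).lTensor H).rTensor H) ∘ₗ
    (Coalgebra.comul (R := k) (A := H)).rTensor H

/-- The map `c ⊗ e ↦ c e⁽¹⁾ e⁽²⁾`. -/
def wadaHopfAux2 : H ⊗[k] H →ₗ[k] H :=
  LinearMap.mul' k H ∘ₗ (LinearMap.mul' k H).lTensor H ∘ₗ
    (Coalgebra.comul (R := k) (A := H)).lTensor H

/-- Wada's third Hopf braiding
`R₃(x ⊗ y) = x⁽¹⁾ S(y⁽¹⁾) S(x⁽²⁾) ⊗ x⁽³⁾ y⁽²⁾ y⁽³⁾`. -/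
def wadaHopfR3 : H ⊗[k] H →ₗ[k] H ⊗[k] H :=
  TensorProduct.map (wadaHopfAux1 k H) (wadaHopfAux2 k H) ∘ₗ
    (TensorProduct.tensorTensorTensorComm k H H H H).toLinearMap ∘ₗ
    TensorProduct.map (Coalgebra.comul (R := k) (A := H))
      (Coalgebra.comul (R := k) (A := H))

namespace HopfAlgebra

variable {k H}

/-- `S(y⁽¹⁾) y⁽²⁾ x y⁽³⁾ = x y`. -/
theorem mul_rTensor_antipode_comul₂ (x y : H) :
    mul' k H ((mulRight k x ∘ₗ mul' k H ∘ₗ (antipode k (A := H)).rTensor H).rTensor H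
      (comul₂ k H y)) = x * y := by
  rw [comul₂, LinearMap.comp_apply, ← LinearMap.comp_apply (rTensor H _), ← rTensor_comp,
    comp_assoc, comp_assoc, mul_antipode_rTensor_comul, ← comp_assoc, rTensor_comp,
    LinearMap.comp_apply, Coalgebra.rTensor_counit_comul]
  simp

/-- `S(y⁽¹⁾) y⁽²⁾ y⁽³⁾ = y`. -/
theorem mul_map_antipode_mul_comul (y : H) :
    mul' k H (TensorProduct.map (antipode k) (mul' k H ∘ₗ Coalgebra.comul)
      (Coalgebra.comul (R := k) y)) = y := by
  have key (t : (H ⊗[k] H) ⊗[k] H) :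
      mul' k H (TensorProduct.map (antipode k) (mul' k H) (TensorProduct.assoc k H H H t)) =
        mul' k H ((mulRight k 1 ∘ₗ mul' k H ∘ₗ (antipode k (A := H)).rTensor H).rTensor H t) := by
    induction t using TensorProduct.induction_on with
    | zero => simp
    | add t u ht hu => simp only [map_add, ht, hu]
    | tmul t c =>
      induction t using TensorProduct.induction_on with
      | zero => simp
      | add t u ht hu => simp only [add_tmul, map_add, ht, hu]
      | tmul a b => simp [mul_assoc]
  have h := mul_rTensor_antipode_comul₂ (k := k) 1 y
  rw [← key, comul₂, LinearMap.comp_apply, Coalgebra.coassoc_apply,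
    ← LinearMap.comp_apply (map _ _), map_comp_lTensor, one_mul] at h
  exact h

/-- `x⁽¹⁾ z S(x⁽²⁾) x⁽³⁾ = x z`. -/
theorem mul_map_mulRight_antipode_comul (x z : H) :
    mul' k H (TensorProduct.map (mulRight k z)
      (mul' k H ∘ₗ (antipode k (A := H)).rTensor H) (TensorProduct.assoc k H H H
        (comul₂ k H x))) = x * z := by
  rw [comul₂, LinearMap.comp_apply, Coalgebra.coassoc_apply, ← LinearMap.comp_apply (map _ _),
    map_comp_lTensor, comp_assoc, mul_antipode_rTensor_comul, ← map_comp_lTensor,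
    LinearMap.comp_apply, Coalgebra.lTensor_counit_comul]
  simp

end HopfAlgebra

/-- `R₂` is braided commutative. -/
theorem mul_comp_wadaHopfR2 : mul' k H ∘ₗ wadaHopfR2 k H = mul' k H := by
  ext x y
  have key (t : (H ⊗[k] H) ⊗[k] H) :
      mul' k H ((HopfAlgebra.antipode k (A := H)).rTensor H
        ((mul' k H).lTensor H (TensorProduct.assoc k H H H
          (((mul' k H).lTensor H ∘ₗ (TensorProduct.assoc k H H H).toLinearMap).rTensor H
            (swapLast k H (t ⊗ₜ[k] x)))))) =
      mul' k H ((mulRight k x ∘ₗ mul' k H ∘ₗ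
        (HopfAlgebra.antipode k (A := H)).rTensor H).rTensor H t) := by
    induction t using TensorProduct.induction_on with
    | zero => simp
    | add t u ht hu => simp only [add_tmul, map_add, ht, hu]
    | tmul t c =>
      induction t using TensorProduct.induction_on with
      | zero => simp
      | add t u ht hu => simp only [add_tmul, map_add, ht, hu]
      | tmul a b => simp [swapLast, mul_assoc]
  have h := key (comul₂ k H y)
  rw [HopfAlgebra.mul_rTensor_antipode_comul₂] at h
  simpa [wadaHopfR2, adjCore] using h

/-- `R₃` is braided commutative. -/
theorem mul_comp_wadaHopfR3 : mul' k H ∘ₗ wadaHopfR3 k H = mul' k H := by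
  ext x y
  have conj (a c d e : H) :
      wadaHopfAux1 k H (a ⊗ₜ d) * wadaHopfAux2 k H (c ⊗ₜ e) =
        mul' k H (TensorProduct.map (mulRight k (HopfAlgebra.antipode k d))
          (mul' k H ∘ₗ (HopfAlgebra.antipode k (A := H)).rTensor H)
          (TensorProduct.assoc k H H H (Coalgebra.comul (R := k) a ⊗ₜ c))) *
          mul' k H (Coalgebra.comul (R := k) e) := by
    simp only [wadaHopfAux1, wadaHopfAux2, LinearMap.comp_apply, rTensor_tmul, lTensor_tmul]
    induction Coalgebra.comul (R := k) a using TensorProduct.induction_on with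
    | zero => simp
    | add t u ht hu => simp only [add_tmul, map_add, add_mul, ht, hu]
    | tmul a b => simp [mul_assoc]
  have cancel (d e : H) :
      mul' k H (TensorProduct.map (wadaHopfAux1 k H) (wadaHopfAux2 k H)
        (TensorProduct.tensorTensorTensorComm k H H H H
          (Coalgebra.comul (R := k) x ⊗ₜ (d ⊗ₜ e)))) =
        x * (HopfAlgebra.antipode k d * mul' k H (Coalgebra.comul (R := k) e)) := by
    rw [← mul_assoc, ← HopfAlgebra.mul_map_mulRight_antipode_comul (k := k) x, comul₂,
      LinearMap.comp_apply]
    induction Coalgebra.comul (R := k) x using TensorProduct.induction_on with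
    | zero => simp
    | add t u ht hu => simp only [add_tmul, map_add, add_mul, ht, hu]
    | tmul a c => simpa using conj a c d e
  have split (t : H ⊗[k] H) :
      mul' k H (TensorProduct.map (wadaHopfAux1 k H) (wadaHopfAux2 k H)
        (TensorProduct.tensorTensorTensorComm k H H H H
          (Coalgebra.comul (R := k) x ⊗ₜ t))) =
        x * mul' k H (TensorProduct.map (HopfAlgebra.antipode k)
          (mul' k H ∘ₗ Coalgebra.comul) t) := by
    induction t using TensorProduct.induction_on with
    | zero => simp
    | add t u ht hu => simp only [tmul_add, map_add, mul_add, ht, hu]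
    | tmul d e => simpa using cancel d e
  have h := split (Coalgebra.comul (R := k) y)
  rw [HopfAlgebra.mul_map_antipode_mul_comul] at h
  simpa [wadaHopfR3] using h

/-- Wada's Hopf-algebra braidings
`R₂(x⊗y) = S(y⁽¹⁾) ⊗ y⁽²⁾xy⁽³⁾` and
`R₃(x⊗y) = x⁽¹⁾S(y⁽¹⁾)S(x⁽²⁾) ⊗ x⁽³⁾y⁽²⁾y⁽³⁾` both satisfy braided
commutativity with the multiplication of `H`. -/
theorem wadaHopf_braided_commutative (k : Type*) [CommRing k] (H : Type*)
    [Ring H] [HopfAlgebra k H] :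
    LinearMap.mul' k H ∘ₗ wadaHopfR2 k H = LinearMap.mul' k H ∧
    LinearMap.mul' k H ∘ₗ wadaHopfR3 k H = LinearMap.mul' k H := by
  exact ⟨mul_comp_wadaHopfR2 k H, mul_comp_wadaHopfR3 k H⟩

end
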